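/- arXiv:2307.00896 — 2 statements merged into one kernel-verified Lean document; each statement's English description precedes it below -/
import Mathlib

section
/- Let α ∈ (0,2), a ∈ (0,3/4) and x ∈ (a, 3/4). Then ∫_1^∞ P_{(a,1)}(x,y) dy ≥ C_α 2^{-α} α^{-1} (x-a)^{α/2}. -/
open MeasureTheory Real Filter Set

/-- Euler Beta function `B(x,y) = ∫₀¹ t^(x-1) (1-t)^(y-1) dt`. -/
noncomputable def betaFn (x y : ℝ) : ℝ :=
  ∫ t in (0:ℝ)..1, t ^ (x - 1) * (1 - t) ^ (y - 1)

/-- `C_α = π⁻¹ sin(π α / 2)`. -/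
noncomputable def Cc (α : ℝ) : ℝ := Real.sin (Real.pi * α / 2) / Real.pi

/-- `T_α = B(α, 1 - α/2)`. -/
noncomputable def Tc (α : ℝ) : ℝ := betaFn α (1 - α / 2)

/-- Poisson kernel of the fractional Laplacian for the interval `(a,1)`:
`P_{(a,1)}(x,y) = C_α (((x-a)(1-x))/((y-a)(y-1)))^(α/2) |x-y|⁻¹`. -/
noncomputable def Pker (α a x y : ℝ) : ℝ :=
  Cc α * (((x - a) * (1 - x)) / ((y - a) * (y - 1))) ^ (α / 2) * |x - y|⁻¹

theorem Cc_nonneg {α : ℝ} (hα : α ∈ Set.Ioo (0:ℝ) 2) : 0 ≤ Cc α := by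
  have hpi := Real.pi_pos
  refine div_nonneg (Real.sin_nonneg_of_nonneg_of_le_pi ?_ ?_) hpi.le <;>
    nlinarith [hα.1, hα.2]

theorem measurable_Pker (α a x : ℝ) : Measurable (Pker α a x) := by
  unfold Pker
  fun_prop

theorem Pker_nonneg {α a x y : ℝ} (hα : α ∈ Set.Ioo (0:ℝ) 2) (hx : x ∈ Set.Ioo a 1)
    (hy : 1 < y) : 0 ≤ Pker α a x y := by
  have h1 : 0 < x - a := sub_pos.2 hx.1
  have h2 : 0 < 1 - x := sub_pos.2 hx.2
  have h3 : 0 < y - 1 := sub_pos.2 hy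
  have h4 : 0 < y - a := by linarith
  have := Cc_nonneg hα
  unfold Pker
  positivity

theorem Pker_le {α a x y : ℝ} (hα : α ∈ Set.Ioo (0:ℝ) 2) (ha : 0 ≤ a)
    (hx : x ∈ Set.Ioo a 1) (hy : 1 < y) :
    Pker α a x y ≤ Cc α * (y - 1) ^ (-(α / 2)) * (y - x)⁻¹ := by
  have h1 : 0 < x - a := sub_pos.2 hx.1
  have h2 : 0 < 1 - x := sub_pos.2 hx.2
  have h3 : 0 < y - 1 := sub_pos.2 hy
  have h4 : 0 < y - a := by linarith
  have h5 : 0 < y - x := by linarith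
  have h6 := hα.1
  have hc := Cc_nonneg hα
  have hr : (x - a) * (1 - x) / ((y - a) * (y - 1)) ≤ (y - 1)⁻¹ := by
    rw [inv_eq_one_div, div_le_div_iff₀ (by positivity) h3, one_mul]
    gcongr
    nlinarith
  unfold Pker
  rw [abs_sub_comm, abs_of_pos h5, rpow_neg h3.le, ← inv_rpow h3.le]
  gcongr

theorem le_Pker {α a x y : ℝ} (hα : α ∈ Set.Ioo (0:ℝ) 2) (ha : 0 ≤ a)
    (hx : x ∈ Set.Ioo a (3 / 4)) (hy : 1 < y) :
    Cc α * (2:ℝ) ^ (-α) * (x - a) ^ (α / 2) * y ^ (-α - 1) ≤ Pker α a x y := by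
  have h1 : 0 < x - a := sub_pos.2 hx.1
  have h2 : 1 / 4 ≤ 1 - x := by linarith [hx.2]
  have h3 : 0 < y - 1 := sub_pos.2 hy
  have h4 : 0 < y - a := by linarith
  have h5 : 0 < y - x := by linarith
  have h6 : 0 < y := by linarith
  have hα0 := hα.1
  have hc := Cc_nonneg hα
  have hr : (x - a) * (2 * y)⁻¹ ^ 2 ≤ (x - a) * (1 - x) / ((y - a) * (y - 1)) := by
    rw [le_div_iff₀ (by positivity), mul_assoc]
    gcongr
    calc (2 * y)⁻¹ ^ 2 * ((y - a) * (y - 1)) ≤ (2 * y)⁻¹ ^ 2 * (y * y) := by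
          gcongr <;> linarith
      _ = 1 / 4 := by field_simp; norm_num
      _ ≤ 1 - x := h2
  have hpow : ((x - a) * (2 * y)⁻¹ ^ 2) ^ (α / 2)
      = (2:ℝ) ^ (-α) * (x - a) ^ (α / 2) * y ^ (-α) := by
    rw [mul_rpow h1.le (by positivity), ← rpow_natCast_mul (by positivity),
      show ((2:ℕ):ℝ) * (α / 2) = α by push_cast; ring, inv_rpow (by positivity),
      mul_rpow (by norm_num) h6.le, rpow_neg (by norm_num), rpow_neg h6.le, mul_inv]
    ring
  unfold Pker
  rw [abs_sub_comm, abs_of_pos h5]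
  calc Cc α * (2:ℝ) ^ (-α) * (x - a) ^ (α / 2) * y ^ (-α - 1)
      = Cc α * ((x - a) * (2 * y)⁻¹ ^ 2) ^ (α / 2) * y⁻¹ := by
        rw [hpow, rpow_sub_one h6.ne']
        ring
    _ ≤ _ := by
        gcongr
        linarith [hx.1]

theorem integrableOn_Pker_Ioi {α a x : ℝ} (hα : α ∈ Set.Ioo (0:ℝ) 2) (ha : 0 ≤ a)
    (hx : x ∈ Set.Ioo a 1) : IntegrableOn (Pker α a x) (Set.Ioi 1) := by
  have hc := Cc_nonneg hα
  have hx1 : 0 < 1 - x := sub_pos.2 hx.2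
  rw [← Set.Ioc_union_Ioi_eq_Ioi (one_le_two : (1:ℝ) ≤ 2)]
  refine IntegrableOn.union ?_ ?_
  · have h : IntegrableOn (fun y : ℝ => (y - 1) ^ (-(α / 2))) (Set.Ioc 1 2) := by
      have h := (intervalIntegral.intervalIntegrable_rpow' (a := 0) (b := 1)
        (r := -(α / 2)) (by linarith [hα.2])).comp_sub_right 1
      norm_num at h
      exact (intervalIntegrable_iff_integrableOn_Ioc_of_le one_le_two).1 h
    refine ((h.const_mul (Cc α)).mul_const (1 - x)⁻¹).mono'
      (measurable_Pker α a x).aestronglyMeasurable ?_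
    filter_upwards [ae_restrict_mem measurableSet_Ioc] with y hy
    have hy1 : 0 < y - 1 := sub_pos.2 hy.1
    rw [norm_of_nonneg (Pker_nonneg hα hx hy.1)]
    refine (Pker_le hα ha hx hy.1).trans ?_
    gcongr
    exact hy.1.le
  · have h := integrableOn_add_rpow_Ioi_of_lt (a := -(α / 2) - 1) (c := 2) (m := -1)
      (by linarith [hα.1]) (by norm_num)
    refine (h.const_mul (Cc α)).mono' (measurable_Pker α a x).aestronglyMeasurable ?_
    filter_upwards [ae_restrict_mem measurableSet_Ioi] with y hy
    have hy2 : 1 < y := one_lt_two.trans hy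
    have hy1 : 0 < y - 1 := sub_pos.2 hy2
    rw [norm_of_nonneg (Pker_nonneg hα hx hy2), ← sub_eq_add_neg, rpow_sub_one hy1.ne',
      div_eq_mul_inv, ← mul_assoc]
    refine (Pker_le hα ha hx hy2).trans ?_
    gcongr
    exact hx.2.le

/-- For `α ∈ (0,2)`, `a ∈ (0,3/4)` and `x ∈ (a,3/4)`,
`∫_1^∞ P_{(a,1)}(x,y) dy ≥ C_α 2^(-α) α⁻¹ (x-a)^(α/2)`. -/
theorem poisson_tail_lower_bound (α a x : ℝ) (hα : α ∈ Set.Ioo (0:ℝ) 2)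
    (ha : a ∈ Set.Ioo (0:ℝ) (3 / 4)) (hx : x ∈ Set.Ioo a (3 / 4)) :
    Cc α * (2:ℝ) ^ (-α) * α⁻¹ * (x - a) ^ (α / 2)
      ≤ ∫ y in Set.Ioi (1:ℝ), Pker α a x y := by
  have hlt : -α - 1 < -1 := by linarith [hα.1]
  have hx1 : x ∈ Set.Ioo a 1 := ⟨hx.1, hx.2.trans (by norm_num)⟩
  calc Cc α * (2:ℝ) ^ (-α) * α⁻¹ * (x - a) ^ (α / 2)
      = ∫ y in Set.Ioi (1:ℝ), Cc α * (2:ℝ) ^ (-α) * (x - a) ^ (α / 2) * y ^ (-α - 1) := by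
        rw [integral_const_mul, integral_Ioi_rpow_of_lt hlt one_pos, one_rpow,
          sub_add_cancel, neg_div_neg_eq, one_div]
        ring
    _ ≤ ∫ y in Set.Ioi (1:ℝ), Pker α a x y :=
        setIntegral_mono_on ((integrableOn_Ioi_rpow_of_lt hlt one_pos).const_mul _)
          (integrableOn_Pker_Ioi hα ha.1.le hx1) measurableSet_Ioi
          fun y hy => le_Pker hα ha.1.le hx hy
end

section
/- Let α ∈ (0,2). Then C_α ( T_α + 1/(α 2^α) ) ≤ inf_{a ∈ (0,1)} Ψ(a) ≤ C_α (2/α)^{α/2} ( T_α + (1/(α 2^α)) (α/(2-α))^α ). -/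
open MeasureTheory Real Filter Set

/-- `fseq α a n` is `f_a^{(n+1)}`: `f_a^{(1)}(x) = ∫_{-a}^a P_{(a,1)}(x,y) dy` and
`f_a^{(n)}(x) = ∫_a^1 P_{(a,1)}(x,-y) f_a^{(n-1)}(y) dy` for `n ≥ 2`. -/
noncomputable def fseq (α a : ℝ) : ℕ → ℝ → ℝ
  | 0 => fun x => ∫ y in (-a)..a, Pker α a x y
  | n + 1 => fun x => ∫ y in a..(1:ℝ), Pker α a x (-y) * fseq α a n y

/-- `f_a(x) = Σ_{n=1}^∞ f_a^{(n)}(x)`. -/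
noncomputable def ff (α a x : ℝ) : ℝ := ∑' n : ℕ, fseq α a n x

/-- `Φ(a,y) = ((y-a)(y-1))^(-α/2) |y-a|⁻¹`. -/
noncomputable def Phi (α a y : ℝ) : ℝ :=
  ((y - a) * (y - 1)) ^ (-(α / 2)) * |y - a|⁻¹

/-- `Ψ(a) = C_α (1-a)^(α/2) (∫_1^∞ Φ(a,y) dy + ∫_a^∞ Φ(a,-y) dy - ∫_a^1 Φ(a,-y) f_a(y) dy)`. -/
noncomputable def Psi (α a : ℝ) : ℝ :=
  Cc α * (1 - a) ^ (α / 2) *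
    ((∫ y in Set.Ioi (1:ℝ), Phi α a y) + (∫ y in Set.Ioi a, Phi α a (-y))
      - ∫ y in a..(1:ℝ), Phi α a (-y) * ff α a y)

lemma betaFn_eq_beta {u v : ℝ} (hu : 0 < u) (hv : 0 < v) :
    betaFn u v = ProbabilityTheory.beta u v := by
  have h : (betaFn u v : ℂ) = Complex.betaIntegral u v := by
    rw [betaFn, Complex.betaIntegral, ← intervalIntegral.integral_ofReal]
    refine intervalIntegral.integral_congr fun t ht => ?_
    rw [uIcc_of_le zero_le_one] at ht
    have h1 : 0 ≤ 1 - t := sub_nonneg.2 ht.2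
    push_cast [Complex.ofReal_cpow ht.1, Complex.ofReal_cpow h1]
    rfl
  rw [ProbabilityTheory.beta_eq_betaIntegralReal u v hu hv, ← h, Complex.ofReal_re]

lemma intervalIntegrable_betaFn {u v : ℝ} (hu : 0 < u) (hv : 0 < v) :
    IntervalIntegrable (fun t : ℝ => t ^ (u - 1) * (1 - t) ^ (v - 1)) volume 0 1 := by
  refine intervalIntegral.intervalIntegrable_of_integral_ne_zero ?_
  have h := betaFn_eq_beta hu hv
  rw [betaFn] at h
  exact h ▸ (ProbabilityTheory.beta_pos hu hv).ne'

lemma betaFn_one_sub {s : ℝ} (h0 : 0 < s) (h1 : s < 1) :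
    betaFn s (1 - s) = π / sin (π * s) := by
  rw [betaFn_eq_beta h0 (by linarith), ProbabilityTheory.beta, Real.Gamma_mul_Gamma_one_sub]
  simp

lemma one_div_le_betaFn {u v : ℝ} (hu : 0 < u) (hv : 0 < v) (hv1 : v ≤ 1) :
    1 / u ≤ betaFn u v := by
  have h : ∫ t in (0:ℝ)..1, t ^ (u - 1) = 1 / u := by
    rw [integral_rpow (Or.inl (by linarith))]
    simp [hu.ne']
  rw [← h, betaFn]
  refine intervalIntegral.integral_mono_on_of_le_Ioo zero_le_one
    (intervalIntegral.intervalIntegrable_rpow' (by linarith))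
    (intervalIntegrable_betaFn hu hv) fun t ht => ?_
  exact le_mul_of_one_le_right (rpow_nonneg ht.1.le _)
    (one_le_rpow_of_pos_of_le_one_of_nonpos (by linarith [ht.2]) (by linarith [ht.1])
      (by linarith))

/-- Substituting `y = q + (p - q) / t` turns a half-line integral into a Beta integral. -/
lemma integral_Ioi_rpow_mul_rpow {p q : ℝ} (hqp : q < p) (s m : ℝ) :
    ∫ y in Ioi p, (y - p) ^ (-s) * (y - q) ^ (-m) =
      (p - q) ^ (1 - s - m) * betaFn (s + m - 1) (1 - s) := by
  have hd : 0 < p - q := sub_pos.2 hqp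
  have himg : (fun t : ℝ => q + (p - q) / t) '' Ioo 0 1 = Ioi p := by
    ext y
    simp only [mem_image, mem_Ioo, mem_Ioi]
    constructor
    · rintro ⟨t, ⟨h0, h1⟩, rfl⟩
      have : p - q < (p - q) / t := by rw [lt_div_iff₀ h0]; nlinarith
      linarith
    · intro hy
      have hyq : 0 < y - q := by linarith
      refine ⟨(p - q) / (y - q), ⟨by positivity, ?_⟩, ?_⟩
      · rw [div_lt_one hyq]; linarith
      · field_simp
        ring
  rw [← himg, integral_image_eq_integral_abs_deriv_smul measurableSet_Ioo
    (f' := fun t => -(p - q) / t ^ 2), betaFn, intervalIntegral.integral_of_le zero_le_one,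
    integral_Ioc_eq_integral_Ioo, ← integral_const_mul]
  · refine setIntegral_congr_fun measurableSet_Ioo fun t ht => ?_
    obtain ⟨h0, h1⟩ := ht
    have h1' : 0 < 1 - t := sub_pos.2 h1
    have e1 : q + (p - q) / t - p = (p - q) * (1 - t) / t := by field_simp; ring
    have e2 : q + (p - q) / t - q = (p - q) / t := by ring
    have e3 : |-(p - q) / t ^ 2| = (p - q) * t ^ (-2 : ℝ) := by
      rw [neg_div, abs_neg, abs_of_pos (by positivity), rpow_neg h0.le, div_eq_mul_inv]
      norm_cast
    simp only [smul_eq_mul]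
    rw [e1, e2, e3, div_rpow (by positivity) h0.le, div_rpow hd.le h0.le,
      mul_rpow hd.le h1'.le, div_eq_mul_inv, div_eq_mul_inv, ← rpow_neg h0.le, ← rpow_neg h0.le,
      show 1 - s - m = 1 + (-s) + (-m) by ring, rpow_add hd, rpow_add hd, rpow_one,
      show s + m - 1 - 1 = -2 + - -s + - -m by ring, rpow_add h0, rpow_add h0,
      show 1 - s - 1 = -s by ring]
    ring
  · intro t ht
    have h := ((hasDerivAt_inv ht.1.ne').const_mul (p - q)).const_add q
    refine (h.congr_deriv ?_).hasDerivWithinAt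
    ring
  · intro t ht u hu h
    have ht0 := ht.1.ne'
    have hu0 := hu.1.ne'
    have h' : (p - q) / t = (p - q) / u := by simpa using h
    rw [div_eq_div_iff ht0 hu0] at h'
    exact (mul_left_cancel₀ hd.ne' h').symm

lemma Cc_pos {α : ℝ} (hα : α ∈ Ioo (0:ℝ) 2) : 0 < Cc α := by
  have h1 : 0 < π * α / 2 := by have := hα.1; positivity
  have h2 : π * α / 2 < π := by nlinarith [hα.2, pi_pos]
  exact div_pos (sin_pos_of_pos_of_lt_pi h1 h2) pi_pos

section Kernel

variable {α a x : ℝ}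

lemma Pker_neg_nonneg (hα : α ∈ Ioo (0:ℝ) 2) (ha : a < 1) (hx : x ∈ Ioo a 1) {z : ℝ}
    (hz : -a < z) : 0 ≤ Pker α a x (-z) := by
  have hC := Cc_pos hα
  have h1 : 0 < x - a := sub_pos.2 hx.1
  have h2 : 0 < 1 - x := sub_pos.2 hx.2
  have h3 : 0 < (-z - a) * (-z - 1) := by nlinarith
  unfold Pker
  positivity

/-- The kernel of the interval is dominated by the kernel of a half-line. -/
lemma Pker_neg_le (hα : α ∈ Ioo (0:ℝ) 2) (hx : x ∈ Ioo a 1) {z : ℝ}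
    (hz : -a < z) :
    Pker α a x (-z) ≤
      Cc α * (x - a) ^ (α / 2) * ((z - -a) ^ (-(α / 2)) * (z - -x) ^ (-(1:ℝ))) := by
  have hC := Cc_pos hα
  have h1 : 0 < x - a := sub_pos.2 hx.1
  have h2 : 0 < 1 - x := sub_pos.2 hx.2
  have h3 : 0 < z - -a := by linarith
  have h4 : 0 < z + 1 := by linarith
  have h5 : 0 < z - -x := by linarith
  have h6 : (x - a) * (1 - x) / ((-z - a) * (-z - 1)) ≤ (x - a) / (z - -a) := by
    rw [show (-z - a) * (-z - 1) = (z - -a) * (z + 1) by ring,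
      div_le_div_iff₀ (by positivity) h3]
    nlinarith [mul_pos (mul_pos h1 h3) h5]
  have h7 : 0 ≤ (x - a) * (1 - x) / ((-z - a) * (-z - 1)) := by
    rw [show (-z - a) * (-z - 1) = (z - -a) * (z + 1) by ring]
    positivity
  have h8 : |x - -z| = z - -x := by
    rw [abs_of_pos (by linarith)]
    ring
  calc Pker α a x (-z)
      ≤ Cc α * ((x - a) / (z - -a)) ^ (α / 2) * (z - -x)⁻¹ := by
        rw [Pker, h8]
        have := rpow_le_rpow h7 h6 (by linarith [hα.1] : 0 ≤ α / 2)
        gcongr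
    _ = _ := by
        rw [div_rpow h1.le h3.le, rpow_neg h3.le, rpow_neg_one]
        ring

lemma measurable_Pker_s18 : Measurable fun p : ℝ × ℝ => Pker α a p.1 p.2 := by
  unfold Pker
  fun_prop

lemma Pker_dominating_integral (hα : α ∈ Ioo (0:ℝ) 2) (hx : a < x) :
    ∫ z in Ioi (-a), Cc α * (x - a) ^ (α / 2) *
      ((z - -a) ^ (-(α / 2)) * (z - -x) ^ (-(1:ℝ))) = 1 := by
  have h1 : 0 < x - a := sub_pos.2 hx
  have hs : sin (π * (α / 2)) ≠ 0 := by
    have := (Cc_pos hα).ne'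
    intro h
    exact this (by rw [Cc, show π * α / 2 = π * (α / 2) by ring, h, zero_div])
  rw [integral_const_mul, integral_Ioi_rpow_mul_rpow (neg_lt_neg hx),
    show α / 2 + 1 - 1 = α / 2 by ring,
    betaFn_one_sub (by linarith [hα.1]) (by linarith [hα.2]),
    show -a - -x = x - a by ring, show 1 - α / 2 - 1 = -(α / 2) by ring, rpow_neg h1.le, Cc,
    show π * α / 2 = π * (α / 2) by ring]
  have := (rpow_pos_of_pos h1 (α / 2)).ne'
  generalize sin (π * (α / 2)) = r at hs ⊢
  field_simp

lemma integrableOn_Pker_neg (hα : α ∈ Ioo (0:ℝ) 2) (ha : a < 1) (hx : x ∈ Ioo a 1) :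
    IntegrableOn (fun z => Pker α a x (-z)) (Ioi (-a)) := by
  have hdom := Pker_dominating_integral hα hx.1
  refine Integrable.mono' (Integrable.of_integral_ne_zero (by rw [hdom]; exact one_ne_zero)) ?_ ?_
  · exact (measurable_Pker_s18.comp (measurable_const.prodMk measurable_neg)).aestronglyMeasurable
  · refine ae_restrict_of_forall_mem measurableSet_Ioi fun z hz => ?_
    rw [norm_of_nonneg (Pker_neg_nonneg hα ha hx hz)]
    exact Pker_neg_le hα hx hz

lemma integral_Pker_neg_le_one (hα : α ∈ Ioo (0:ℝ) 2) (ha : a < 1) (hx : x ∈ Ioo a 1) :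
    ∫ z in Ioi (-a), Pker α a x (-z) ≤ 1 := by
  have hdom := Pker_dominating_integral hα hx.1
  rw [← hdom]
  exact setIntegral_mono_on (integrableOn_Pker_neg hα ha hx)
    (Integrable.of_integral_ne_zero (by rw [hdom]; exact one_ne_zero)) measurableSet_Ioi
    fun z hz => Pker_neg_le hα hx hz

lemma fseq_zero_eq (ha : 0 ≤ a) : fseq α a 0 x = ∫ z in Ioc (-a) a, Pker α a x (-z) := by
  rw [fseq, ← intervalIntegral.integral_of_le (by linarith),
    intervalIntegral.integral_comp_neg (fun y => Pker α a x y), neg_neg]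

lemma fseq_succ_eq (ha : a ≤ 1) (n : ℕ) :
    fseq α a (n + 1) x = ∫ y in Ioo a 1, Pker α a x (-y) * fseq α a n y := by
  simp only [fseq]
  rw [intervalIntegral.integral_of_le ha, integral_Ioc_eq_integral_Ioo]

lemma measurable_fseq (ha : a ∈ Ioo (0:ℝ) 1) (n : ℕ) : Measurable (fseq α a n) := by
  have hP : Measurable fun p : ℝ × ℝ => Pker α a p.1 (-p.2) :=
    measurable_Pker_s18.comp (measurable_fst.prodMk measurable_snd.neg)
  induction n with
  | zero =>
    rw [show fseq α a 0 = _ from funext fun x => fseq_zero_eq ha.1.le]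
    exact (StronglyMeasurable.integral_prod_right hP.stronglyMeasurable).measurable
  | succ n ih =>
    rw [show fseq α a (n + 1) = _ from funext fun x => fseq_succ_eq ha.2.le n]
    exact (StronglyMeasurable.integral_prod_right
      (hP.mul (ih.comp measurable_snd)).stronglyMeasurable).measurable

lemma fseq_nonneg (hα : α ∈ Ioo (0:ℝ) 2) (ha : a ∈ Ioo (0:ℝ) 1) (n : ℕ) (hx : x ∈ Ioo a 1) :
    0 ≤ fseq α a n x := by
  induction n generalizing x with
  | zero =>
    rw [fseq_zero_eq ha.1.le]
    exact setIntegral_nonneg measurableSet_Ioc fun z hz => Pker_neg_nonneg hα ha.2 hx hz.1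
  | succ n ih =>
    rw [fseq_succ_eq ha.2.le]
    exact setIntegral_nonneg measurableSet_Ioo fun y hy =>
      mul_nonneg (Pker_neg_nonneg hα ha.2 hx (by linarith [hy.1, ha.1])) (ih hy)

lemma sum_fseq_le_one (hα : α ∈ Ioo (0:ℝ) 2) (ha : a ∈ Ioo (0:ℝ) 1) (N : ℕ)
    (hx : x ∈ Ioo a 1) : ∑ n ∈ Finset.range N, fseq α a n x ≤ 1 := by
  induction N generalizing x with
  | zero => simp
  | succ N ih =>
    have haa : -a ≤ a := by linarith [ha.1]
    have hI := integrableOn_Pker_neg hα ha.2 hx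
    have hIoo : Ioo a 1 ⊆ Ioi (-a) := fun y hy => lt_of_le_of_lt haa hy.1
    have hP : ∀ y ∈ Ioo a 1, 0 ≤ Pker α a x (-y) := fun y hy =>
      Pker_neg_nonneg hα ha.2 hx (hIoo hy)
    have hint : ∀ n ∈ Finset.range N,
        IntegrableOn (fun y => Pker α a x (-y) * fseq α a n y) (Ioo a 1) := by
      intro n hn
      refine Integrable.mono' (hI.mono_set hIoo) ?_ ?_
      · exact ((measurable_Pker_s18.comp (measurable_const.prodMk measurable_neg)).mul
          (measurable_fseq ha n)).aestronglyMeasurable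
      · refine ae_restrict_of_forall_mem measurableSet_Ioo fun y hy => ?_
        have h0 := fseq_nonneg hα ha n hy
        rw [norm_of_nonneg (mul_nonneg (hP y hy) h0)]
        exact mul_le_of_le_one_right (hP y hy) <|
          (Finset.single_le_sum (fun m _ => fseq_nonneg hα ha m hy) hn).trans (ih hy)
    have hstep : ∑ n ∈ Finset.range N, fseq α a (n + 1) x ≤
        ∫ y in Ioo a 1, Pker α a x (-y) := by
      simp_rw [fseq_succ_eq ha.2.le]
      rw [← integral_finsetSum _ hint]
      refine setIntegral_mono_on (integrable_finsetSum _ hint) (hI.mono_set hIoo)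
        measurableSet_Ioo fun y hy => ?_
      rw [← Finset.mul_sum]
      exact mul_le_of_le_one_right (hP y hy) (ih hy)
    have hdisj : Disjoint (Ioc (-a) a) (Ioo a 1) :=
      Set.disjoint_left.2 fun y hy hy' => not_lt.2 hy.2 hy'.1
    have hIoc : Ioc (-a) a ⊆ Ioi (-a) := fun y hy => hy.1
    calc ∑ n ∈ Finset.range (N + 1), fseq α a n x
        ≤ (∫ y in Ioo a 1, Pker α a x (-y)) + ∫ y in Ioc (-a) a, Pker α a x (-y) := by
          rw [Finset.sum_range_succ', fseq_zero_eq ha.1.le]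
          gcongr
      _ = ∫ y in Ioc (-a) a ∪ Ioo a 1, Pker α a x (-y) := by
          rw [setIntegral_union hdisj measurableSet_Ioo (hI.mono_set hIoc) (hI.mono_set hIoo),
            add_comm]
      _ ≤ ∫ y in Ioi (-a), Pker α a x (-y) :=
          setIntegral_mono_set hI
            (ae_restrict_of_forall_mem measurableSet_Ioi fun y hy =>
              Pker_neg_nonneg hα ha.2 hx hy)
            (union_subset hIoc hIoo).eventuallyLE
      _ ≤ 1 := integral_Pker_neg_le_one hα ha.2 hx

lemma ff_nonneg (hα : α ∈ Ioo (0:ℝ) 2) (ha : a ∈ Ioo (0:ℝ) 1) (hx : x ∈ Ioo a 1) :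
    0 ≤ ff α a x :=
  tsum_nonneg fun n => fseq_nonneg hα ha n hx

lemma ff_le_one (hα : α ∈ Ioo (0:ℝ) 2) (ha : a ∈ Ioo (0:ℝ) 1) (hx : x ∈ Ioo a 1) :
    ff α a x ≤ 1 :=
  Real.tsum_le_of_sum_range_le (fun n => fseq_nonneg hα ha n hx)
    fun N => sum_fseq_le_one hα ha N hx

end Kernel

section Psi

variable {α a : ℝ}

lemma Phi_neg_nonneg (y : ℝ) (ha : a ∈ Ioo (0:ℝ) 1) (hy : a < y) : 0 ≤ Phi α a (-y) := by
  have h : 0 < (-y - a) * (-y - 1) := by nlinarith [ha.1, ha.2]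
  unfold Phi
  positivity

lemma Phi_neg_eq {y : ℝ} (ha : a ∈ Ioo (0:ℝ) 1) (hy : a < y) :
    Phi α a (-y) = (y + a) ^ (-(α / 2) - 1) * (y + 1) ^ (-(α / 2)) := by
  have h1 : 0 < y + a := by linarith [ha.1]
  have h2 : 0 < y + 1 := by linarith [ha.1]
  rw [Phi, show (-y - a) * (-y - 1) = (y + a) * (y + 1) by ring, mul_rpow h1.le h2.le,
    show -y - a = -(y + a) by ring, abs_neg, abs_of_pos h1, rpow_sub_one h1.ne']
  ring

lemma Phi_neg_le (hα : 0 < α) {y : ℝ} (ha : a ∈ Ioo (0:ℝ) 1) (hy : a < y) :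
    Phi α a (-y) ≤ (y + a) ^ (-α - 1) := by
  have h1 : 0 < y + a := by linarith [ha.1]
  rw [Phi_neg_eq ha hy, show -α - 1 = -(α / 2) - 1 + -(α / 2) by ring,
    rpow_add h1 (-(α / 2) - 1)]
  have := rpow_le_rpow_of_nonpos h1 (by linarith [ha.2] : y + a ≤ y + 1)
    (by linarith : -(α / 2) ≤ 0)
  gcongr

lemma le_Phi_neg (hα : 0 < α) {y : ℝ} (ha : a ∈ Ioo (0:ℝ) 1) (hy : a < y) :
    (y + 1) ^ (-α - 1) ≤ Phi α a (-y) := by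
  have h1 : 0 < y + a := by linarith [ha.1]
  have h2 : 0 < y + 1 := by linarith [ha.1]
  rw [Phi_neg_eq ha hy, show -α - 1 = -(α / 2) - 1 + -(α / 2) by ring,
    rpow_add h2 (-(α / 2) - 1)]
  have := rpow_le_rpow_of_nonpos h1 (by linarith [ha.2] : y + a ≤ y + 1)
    (by linarith : -(α / 2) - 1 ≤ 0)
  gcongr

lemma integral_Ioi_add_rpow (hα : 0 < α) {c m : ℝ} (h : 0 < c + m) :
    ∫ y in Ioi c, (y + m) ^ (-α - 1) = (c + m) ^ (-α) / α := by
  have := (measurePreserving_add_right volume m).setIntegral_preimage_emb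
    (measurableEmbedding_addRight m) (fun y : ℝ => y ^ (-α - 1)) (Ioi (c + m))
  rw [preimage_add_const_Ioi, add_sub_cancel_right] at this
  rw [this, integral_Ioi_rpow_of_lt (by linarith) h, show -α - 1 + 1 = -α by ring, neg_div_neg_eq]

lemma integrableOn_Phi_neg (hα : 0 < α) (ha : a ∈ Ioo (0:ℝ) 1) :
    IntegrableOn (fun y => Phi α a (-y)) (Ioi a) := by
  refine Integrable.mono' (integrableOn_add_rpow_Ioi_of_lt (by linarith : -α - 1 < -1)
    (by linarith [ha.1] : -a < a)) ?_ ?_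
  · refine Measurable.aestronglyMeasurable ?_
    unfold Phi
    fun_prop
  · refine ae_restrict_of_forall_mem measurableSet_Ioi fun y hy => ?_
    rw [norm_of_nonneg (Phi_neg_nonneg y ha hy)]
    exact Phi_neg_le hα ha hy

lemma integral_Phi_neg_le (hα : 0 < α) (ha : a ∈ Ioo (0:ℝ) 1) :
    ∫ y in Ioi a, Phi α a (-y) ≤ (a + a) ^ (-α) / α := by
  rw [← integral_Ioi_add_rpow hα (by linarith [ha.1] : 0 < a + a)]
  exact setIntegral_mono_on (integrableOn_Phi_neg hα ha)
    (integrableOn_add_rpow_Ioi_of_lt (by linarith) (by linarith [ha.1])) measurableSet_Ioi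
    fun y hy => Phi_neg_le hα ha hy

lemma le_integral_Ioi_one_Phi_neg (hα : 0 < α) (ha : a ∈ Ioo (0:ℝ) 1) :
    (2:ℝ) ^ (-α) / α ≤ ∫ y in Ioi (1:ℝ), Phi α a (-y) := by
  rw [← one_add_one_eq_two, ← integral_Ioi_add_rpow hα (by norm_num : (0:ℝ) < 1 + 1)]
  exact setIntegral_mono_on (integrableOn_add_rpow_Ioi_of_lt (by linarith) (by norm_num))
    ((integrableOn_Phi_neg hα ha).mono_set (Ioi_subset_Ioi ha.2.le)) measurableSet_Ioi
    fun y hy => le_Phi_neg hα ha (ha.2.trans hy)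

lemma integral_Ioi_one_Phi (ha : a < 1) :
    ∫ y in Ioi (1:ℝ), Phi α a y = (1 - a) ^ (-α) * Tc α := by
  have h := integral_Ioi_rpow_mul_rpow ha (α / 2) (α / 2 + 1)
  rw [show 1 - α / 2 - (α / 2 + 1) = -α by ring, show α / 2 + (α / 2 + 1) - 1 = α by ring] at h
  rw [Tc, ← h]
  refine setIntegral_congr_fun measurableSet_Ioi fun y hy => ?_
  have h1 : 0 < y - 1 := sub_pos.2 hy
  have h2 : 0 < y - a := by linarith
  rw [Phi, mul_rpow h2.le h1.le, abs_of_pos h2, neg_add, ← sub_eq_add_neg, rpow_sub_one h2.ne']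
  ring

lemma integral_Phi_neg_mul_ff_nonneg (hα : α ∈ Ioo (0:ℝ) 2) (ha : a ∈ Ioo (0:ℝ) 1) :
    0 ≤ ∫ y in a..(1:ℝ), Phi α a (-y) * ff α a y := by
  rw [intervalIntegral.integral_of_le ha.2.le, integral_Ioc_eq_integral_Ioo]
  exact setIntegral_nonneg measurableSet_Ioo fun y hy =>
    mul_nonneg (Phi_neg_nonneg y ha hy.1) (ff_nonneg hα ha hy)

lemma integral_Phi_neg_mul_ff_le (hα : α ∈ Ioo (0:ℝ) 2) (ha : a ∈ Ioo (0:ℝ) 1) :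
    ∫ y in a..(1:ℝ), Phi α a (-y) * ff α a y ≤ ∫ y in Ioc a 1, Phi α a (-y) := by
  rw [intervalIntegral.integral_of_le ha.2.le, integral_Ioc_eq_integral_Ioo,
    integral_Ioc_eq_integral_Ioo]
  refine integral_mono_of_nonneg ?_
    ((integrableOn_Phi_neg hα.1 ha).mono_set fun y hy => hy.1) ?_
  · exact ae_restrict_of_forall_mem measurableSet_Ioo fun y hy =>
      mul_nonneg (Phi_neg_nonneg y ha hy.1) (ff_nonneg hα ha hy)
  · exact ae_restrict_of_forall_mem measurableSet_Ioo fun y hy =>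
      mul_le_of_le_one_right (Phi_neg_nonneg y ha hy.1) (ff_le_one hα ha hy)

lemma le_Psi (hα : α ∈ Ioo (0:ℝ) 2) (ha : a ∈ Ioo (0:ℝ) 1) :
    Cc α * (Tc α + 1 / (α * (2:ℝ) ^ α)) ≤ Psi α a := by
  have hα0 := hα.1
  have hb : 0 < 1 - a := sub_pos.2 ha.2
  have hsplit : ∫ y in Ioi a, Phi α a (-y) =
      (∫ y in Ioc a 1, Phi α a (-y)) + ∫ y in Ioi (1:ℝ), Phi α a (-y) := by
    have hI := integrableOn_Phi_neg hα0 ha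
    rw [← Ioc_union_Ioi_eq_Ioi ha.2.le, setIntegral_union (Ioc_disjoint_Ioi le_rfl)
      measurableSet_Ioi (hI.mono_set Ioc_subset_Ioi_self)
      (hI.mono_set (Ioi_subset_Ioi ha.2.le))]
  have hff := integral_Phi_neg_mul_ff_le hα ha
  have htail := le_integral_Ioi_one_Phi_neg hα0 ha
  set c : ℝ := 1 / (α * (2:ℝ) ^ α) with hc
  have hc0 : 0 < c := by positivity
  have hc' : (2:ℝ) ^ (-α) / α = c := by
    rw [rpow_neg zero_le_two, hc]
    field_simp
  have hcT : c ≤ Tc α := by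
    refine le_trans ?_ (one_div_le_betaFn hα0 (by linarith [hα.2]) (by linarith))
    exact one_div_le_one_div_of_le hα0
      (le_mul_of_one_le_right hα0.le (one_le_rpow one_le_two hα0.le))
  set t : ℝ := (1 - a) ^ (α / 2) with ht
  have ht0 : 0 < t := rpow_pos_of_pos hb _
  have ht1 : t ≤ 1 := rpow_le_one hb.le (by linarith [ha.1]) (by linarith)
  have hbt : (1 - a) ^ (-α) = (t * t)⁻¹ := by
    rw [rpow_neg hb.le, ht, ← rpow_add hb, add_halves]
  rw [Psi, integral_Ioi_one_Phi ha.2, hbt, mul_assoc]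
  refine mul_le_mul_of_nonneg_left ?_ (Cc_pos hα).le
  calc Tc α + c ≤ t * ((t * t)⁻¹ * Tc α + c) := by
        have e : t * ((t * t)⁻¹ * Tc α + c) = (Tc α + t ^ 2 * c) / t := by field_simp
        rw [e, le_div_iff₀ ht0]
        nlinarith [mul_nonneg (sub_nonneg.2 ht1)
          (sub_nonneg.2 ((mul_le_of_le_one_left hc0.le ht1).trans hcT))]
    _ ≤ _ := by
        refine mul_le_mul_of_nonneg_left ?_ ht0.le
        linarith

lemma Psi_le (hα : α ∈ Ioo (0:ℝ) 2) (ha : a ∈ Ioo (0:ℝ) 1) :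
    Psi α a ≤
      Cc α * (1 - a) ^ (-(α / 2)) * (Tc α + 1 / (α * (2:ℝ) ^ α) * ((1 - a) / a) ^ α) := by
  have hα0 := hα.1
  have ha0 := ha.1
  have hb : 0 < 1 - a := sub_pos.2 ha.2
  have h1 := integral_Phi_neg_le hα0 ha
  have h2 := integral_Phi_neg_mul_ff_nonneg hα ha
  have hC := Cc_pos hα
  calc Psi α a
      ≤ Cc α * (1 - a) ^ (α / 2) * ((1 - a) ^ (-α) * Tc α + (a + a) ^ (-α) / α) := by
        rw [Psi, integral_Ioi_one_Phi ha.2]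
        refine mul_le_mul_of_nonneg_left ?_ (by positivity)
        linarith
    _ = _ := by
        rw [← two_mul, mul_rpow zero_le_two ha0.le, div_rpow hb.le ha0.le,
          rpow_neg hb.le, rpow_neg zero_le_two, rpow_neg ha0.le, rpow_neg hb.le,
          show (1 - a) ^ α = (1 - a) ^ (α / 2) * (1 - a) ^ (α / 2) by
            rw [← rpow_add hb, add_halves]]
        have := (rpow_pos_of_pos hb (α / 2)).ne'
        field_simp

end Psi

/-- `C_α (T_α + 1/(α 2^α)) ≤ inf_{a ∈ (0,1)} Ψ(a)
  ≤ C_α (2/α)^(α/2) (T_α + (1/(α 2^α)) (α/(2-α))^α)`. -/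
theorem Psi_inf_bounds (α : ℝ) (hα : α ∈ Set.Ioo (0:ℝ) 2) :
    Cc α * (Tc α + 1 / (α * (2:ℝ) ^ α)) ≤ sInf (Psi α '' Set.Ioo (0:ℝ) 1) ∧
    sInf (Psi α '' Set.Ioo (0:ℝ) 1)
      ≤ Cc α * (2 / α) ^ (α / 2) * (Tc α + 1 / (α * (2:ℝ) ^ α) * (α / (2 - α)) ^ α) := by
  have hlow : ∀ r ∈ Psi α '' Ioo (0:ℝ) 1, Cc α * (Tc α + 1 / (α * (2:ℝ) ^ α)) ≤ r := by
    rintro _ ⟨a, ha, rfl⟩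
    exact le_Psi hα ha
  have ha : 1 - α / 2 ∈ Ioo (0:ℝ) 1 := ⟨by linarith [hα.2], by linarith [hα.1]⟩
  refine ⟨le_csInf ⟨_, mem_image_of_mem _ ha⟩ hlow,
    (csInf_le ⟨_, hlow⟩ (mem_image_of_mem _ ha)).trans ((Psi_le hα ha).trans_eq ?_)⟩
  have h2 : 0 < 2 - α := sub_pos.2 hα.2
  rw [sub_sub_cancel, rpow_neg (by linarith [hα.1]), ← inv_rpow (by linarith [hα.1]), inv_div,
    show α / 2 / (1 - α / 2) = α / (2 - α) by field_simp]
end
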